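/- arXiv:1510.00892 — 2 statements merged into one kernel-verified Lean document; each statement's English description precedes it below -/
import Mathlib

section
/- In any algebra A in I₂,₀, the relation defined by x ⊑ y iff (x → y')' = x is a partial order on A. -/
/-- An implication zroupoid whose negation `x ⇝ 0` is involutive. -/
class InvolutiveZroupoid (A : Type*) extends Zero A where
  imp : A → A → A
  imp_imp (x y w : A) :
    imp (imp x y) w = imp (imp (imp (imp w 0) x) (imp (imp y w) 0)) 0
  imp_zero_imp_zero (x : A) : imp (imp x 0) 0 = x

namespace InvolutiveZroupoid

local infixr:60 "⇝" => InvolutiveZroupoid.imp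
local notation:max x "†" => InvolutiveZroupoid.imp x 0

variable {A : Type*} [InvolutiveZroupoid A]

theorem neg_neg (x : A) : x†† = x := imp_zero_imp_zero x

theorem neg_imp_imp_neg_neg (x y w : A) : ((x† ⇝ y) ⇝ (w ⇝ x)†)† = (y ⇝ w) ⇝ x :=
  (imp_imp y w x).symm

theorem neg_zero_imp (x : A) : 0† ⇝ x = x := by
  calc 0† ⇝ x
    _ = ((0† ⇝ x) ⇝ 0††)† := by rw [neg_neg 0, neg_neg (0† ⇝ x)]
    _ = x := by rw [neg_imp_imp_neg_neg 0 x 0, neg_neg x]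

theorem imp_imp_imp_neg_neg_neg (x y w : A) : ((x ⇝ y) ⇝ (w ⇝ x†)†)† = (y ⇝ w) ⇝ x† := by
  rw [← neg_imp_imp_neg_neg x† y w, neg_neg x]

theorem imp_imp_neg_neg (x y : A) : (x ⇝ (y ⇝ x)†)† = (0 ⇝ y) ⇝ x := by
  rw [← neg_imp_imp_neg_neg x 0 y, neg_neg x]

theorem neg_imp_neg_zero (x : A) : x† ⇝ 0† = 0 ⇝ x := by
  rw [← imp_imp_imp_neg_neg_neg 0 x 0, ← neg_neg (0 ⇝ 0†), ← neg_zero_imp (0 ⇝ 0†)†,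
    imp_imp_neg_neg 0† 0, neg_zero_imp 0†, neg_neg 0, neg_neg (0 ⇝ x)]

theorem zero_imp_imp_neg_neg (x y : A) : ((0 ⇝ x) ⇝ (y ⇝ x)†)† = y ⇝ x := by
  calc ((0 ⇝ x) ⇝ (y ⇝ x)†)†
    _ = ((0 ⇝ x) ⇝ (y ⇝ x††)†)† := by rw [neg_neg x]
    _ = y ⇝ x := by
      rw [← neg_imp_neg_zero x, imp_imp_imp_neg_neg_neg x† 0† y, neg_zero_imp y, neg_neg x]

theorem zero_imp_imp_neg_self (x : A) : (0 ⇝ x) ⇝ x† = x† := by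
  calc (0 ⇝ x) ⇝ x†
    _ = ((0 ⇝ x) ⇝ (0† ⇝ x)†)†† := by rw [← neg_neg ((0 ⇝ x) ⇝ x†), neg_zero_imp x]
    _ = x† := by rw [zero_imp_imp_neg_neg x 0†, neg_zero_imp x]

theorem zero_imp_neg_imp_self (x : A) : (0 ⇝ x†) ⇝ x = x := by
  calc (0 ⇝ x†) ⇝ x
    _ = (0 ⇝ x†) ⇝ x†† := by rw [neg_neg x]
    _ = x := by rw [zero_imp_imp_neg_self x†, neg_neg x]

theorem imp_neg_zero (x : A) : x ⇝ 0† = 0 ⇝ x† := by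
  rw [← neg_imp_neg_zero x†, neg_neg x]

theorem zero_imp_neg_zero_imp (x : A) : 0 ⇝ (0 ⇝ x)† = x ⇝ 0† := by
  rw [← imp_neg_zero (0 ⇝ x), ← imp_imp_neg_neg 0† x, neg_zero_imp (x ⇝ 0†)†, neg_neg (x ⇝ 0†)]

theorem zero_imp_neg_imp_neg_zero (x : A) : 0 ⇝ (x ⇝ 0†)† = 0 ⇝ x := by
  rw [imp_neg_zero x, zero_imp_neg_zero_imp x†, imp_neg_zero x†, neg_neg x]

theorem zero_imp_imp_neg_zero (x : A) : 0 ⇝ (x ⇝ 0†) = x ⇝ 0† := by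
  calc 0 ⇝ (x ⇝ 0†)
    _ = 0 ⇝ (x ⇝ 0†)†† := by rw [neg_neg (x ⇝ 0†)]
    _ = x ⇝ 0† := by
      rw [← imp_neg_zero (x ⇝ 0†)†, ← zero_imp_neg_zero_imp (x ⇝ 0†)†,
        zero_imp_neg_imp_neg_zero x, zero_imp_neg_zero_imp x]

theorem zero_imp_zero_imp (x : A) : 0 ⇝ (0 ⇝ x) = 0 ⇝ x := by
  rw [← neg_neg x, ← imp_neg_zero x†, zero_imp_imp_neg_zero x†, imp_neg_zero x†]

theorem imp_neg_self (x : A) : x ⇝ x† = x† := by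
  calc x ⇝ x†
    _ = (x ⇝ ((0 ⇝ x†) ⇝ x)†)†† := by rw [← neg_neg (x ⇝ x†), zero_imp_neg_imp_self x]
    _ = x† := by rw [imp_imp_neg_neg x (0 ⇝ x†), zero_imp_zero_imp x†, zero_imp_neg_imp_self x]

theorem neg_imp_self (x : A) : x† ⇝ x = x := by
  calc x† ⇝ x
    _ = x† ⇝ x†† := by rw [neg_neg x]
    _ = x := by rw [imp_neg_self x†, neg_neg x]

theorem neg_imp_imp_self (x y : A) : ((x ⇝ y) ⇝ x)† = (y ⇝ x) ⇝ x† := by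
  calc ((x ⇝ y) ⇝ x)†
    _ = (((0† ⇝ x) ⇝ y) ⇝ ((0† ⇝ 0†) ⇝ x))† := by rw [neg_zero_imp 0†, neg_zero_imp x]
    _ = (y ⇝ x) ⇝ x† := by
      rw [← imp_imp_neg_neg 0† 0, neg_zero_imp (0 ⇝ 0†)†, neg_neg (0 ⇝ 0†), ← neg_neg (0† ⇝ x),
        ← neg_imp_imp_neg_neg x 0 0†, neg_imp_imp_neg_neg (0† ⇝ x)† y x††, neg_neg x,
        neg_zero_imp x]

theorem neg_imp_imp_neg (x y w : A) : (x† ⇝ y) ⇝ (w ⇝ x)† = ((y ⇝ w) ⇝ x)† := by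
  rw [← neg_neg ((x† ⇝ y) ⇝ (w ⇝ x)†), neg_imp_imp_neg_neg x y w]

theorem imp_imp_neg_right (x y : A) : (x ⇝ y) ⇝ y† = y ⇝ (x ⇝ y)† := by
  calc (x ⇝ y) ⇝ y†
    _ = ((y†† ⇝ x) ⇝ y)† := by rw [← neg_imp_imp_self y x, neg_neg y]
    _ = y ⇝ (x ⇝ y)† := by rw [← neg_imp_imp_neg y y†† x, imp_neg_self y†, neg_neg y]

theorem zero_imp_imp (x y : A) : (0 ⇝ x) ⇝ y = (y ⇝ x) ⇝ y := by
  calc (0 ⇝ x) ⇝ y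
    _ = (y†† ⇝ x) ⇝ (y ⇝ ((0 ⇝ y†) ⇝ y)†)† := by
      rw [← imp_imp_neg_neg y x, ← imp_imp_neg_right x y, ← neg_imp_imp_neg y† x y,
        zero_imp_neg_imp_self y]
    _ = (y ⇝ x) ⇝ y := by
      rw [imp_imp_neg_neg y (0 ⇝ y†), zero_imp_zero_imp y†, zero_imp_neg_imp_self y, neg_neg y]

theorem neg_imp_neg_imp_self (x y : A) : (x ⇝ (y ⇝ x)†)† = (x ⇝ y) ⇝ x := by
  rw [imp_imp_neg_neg x y, zero_imp_imp y x]

theorem imp_neg_imp_self_imp_imp (x y w v : A) :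
    (((x ⇝ (y ⇝ x)†) ⇝ w) ⇝ (v ⇝ ((0 ⇝ y) ⇝ x))†)† = (w ⇝ v) ⇝ ((0 ⇝ y) ⇝ x) := by
  rw [← imp_imp_neg_neg x y, imp_imp_imp_neg_neg_neg (x ⇝ (y ⇝ x)†) w v]

theorem neg_imp_imp_neg_zero (x y : A) : x† ⇝ (y ⇝ 0†) = 0 ⇝ (x ⇝ y)† := by
  rw [← zero_imp_neg_zero_imp y, ← imp_neg_zero (0 ⇝ y), ← imp_neg_imp_self_imp_imp 0† y x 0,
    zero_imp_imp_neg_zero (0 ⇝ y), neg_zero_imp (y ⇝ 0†)†, imp_neg_zero (0 ⇝ y),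
    zero_imp_neg_zero_imp y, ← zero_imp_imp x (y ⇝ 0†)†, ← neg_neg ((0 ⇝ x) ⇝ (y ⇝ 0†)†),
    imp_imp_imp_neg_neg_neg 0 x y, imp_neg_zero (x ⇝ y), neg_neg (0 ⇝ (x ⇝ y)†)]

theorem imp_neg_zero_imp_neg (x y : A) : (x ⇝ 0†) ⇝ y† = (x ⇝ y) ⇝ y† := by
  rw [← imp_imp_imp_neg_neg_neg y x 0†, neg_zero_imp y†, neg_neg y, neg_imp_imp_self y x]

theorem zero_imp_imp_comm (x y : A) : 0 ⇝ (x ⇝ y) = x ⇝ (0 ⇝ y) := by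
  rw [← neg_neg (x ⇝ y), ← imp_neg_zero (x ⇝ y)†, ← zero_imp_neg_zero_imp (x ⇝ y)†,
    ← neg_imp_imp_neg_zero x y, ← neg_imp_imp_neg_zero x† (y ⇝ 0†), neg_neg x,
    imp_neg_zero_imp_neg y 0, imp_imp_neg_right y 0, ← neg_neg (0 ⇝ y††), imp_imp_neg_neg 0 y,
    neg_neg (0 ⇝ y)]

theorem imp_neg_imp_right (x y : A) : (x ⇝ y†) ⇝ y = (x ⇝ 0†) ⇝ y := by
  rw [← neg_imp_imp_neg_neg y x 0†, neg_zero_imp y, neg_imp_imp_self y† x, neg_neg y]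

theorem imp_imp_imp_cancel (x y : A) : ((x ⇝ y) ⇝ x) ⇝ y = x ⇝ y := by
  rw [← neg_neg (x ⇝ y), ← neg_imp_imp_neg_neg y (x ⇝ y)†† x, imp_neg_imp_right y† (x ⇝ y)†,
    neg_imp_imp_neg y 0† x, neg_zero_imp x]

theorem zero_imp_zero_imp_imp (x y : A) : 0 ⇝ ((0 ⇝ x) ⇝ y) = 0 ⇝ (x ⇝ y) := by
  rw [zero_imp_imp_comm (0 ⇝ x) y, zero_imp_imp x (0 ⇝ y), zero_imp_imp y x,
    ← zero_imp_imp_comm ((x ⇝ y) ⇝ x) y, imp_imp_imp_cancel x y]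

theorem zero_imp_imp_neg (x y : A) : (0 ⇝ x) ⇝ (y ⇝ x)† = (y ⇝ x)† := by
  rw [← neg_imp_neg_zero x, neg_imp_imp_neg x 0† y, neg_zero_imp y]

theorem zero_imp_imp_imp_self (x y : A) : ((0 ⇝ x) ⇝ y) ⇝ x = y ⇝ x := by
  rw [← neg_neg (((0 ⇝ x) ⇝ y) ⇝ x), ← neg_imp_imp_neg x (0 ⇝ x) y,
    ← zero_imp_imp_neg_neg (0 ⇝ x) x†, zero_imp_zero_imp x, imp_imp_neg_neg (0 ⇝ x) x†,
    ← imp_neg_zero x, ← neg_neg (0 ⇝ x), ← zero_imp_neg_zero_imp x,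
    zero_imp_imp_neg_self (0 ⇝ x)†, neg_neg (0 ⇝ x), zero_imp_imp_neg x y, neg_neg (y ⇝ x)]

theorem zero_imp_imp_neg_of_le {a b : A} (h : a ⇝ b† = a†) : (0 ⇝ a) ⇝ b† = (b† ⇝ a)† := by
  rw [zero_imp_imp a b†, ← neg_imp_neg_imp_self b† a, h, neg_neg a]

theorem zero_imp_imp_imp (x y : A) : (0 ⇝ x) ⇝ (x ⇝ y) = x ⇝ (x ⇝ y) := by
  rw [zero_imp_imp x (x ⇝ y), ← zero_imp_imp y x, ← zero_imp_zero_imp y,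
    ← imp_imp_neg_neg x (0 ⇝ y), zero_imp_imp y x, imp_imp_neg_neg x (x ⇝ y),
    zero_imp_imp_imp_self (x ⇝ y) x]

theorem imp_neg_neg_imp_self (x y : A) : x ⇝ (y† ⇝ x)† = (0 ⇝ y) ⇝ x† := by
  calc x ⇝ (y† ⇝ x)†
    _ = ((y ⇝ 0††) ⇝ x) ⇝ x† := by rw [← imp_imp_neg_right y† x, neg_neg 0]
    _ = (0 ⇝ y) ⇝ x† := by
      rw [← imp_neg_zero_imp_neg (y ⇝ 0††) x, imp_neg_imp_right y 0†, imp_neg_zero_imp_neg y 0,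
        imp_imp_neg_right y 0, neg_neg y]

theorem neg_imp_neg_zero_imp_neg (x y : A) : x† ⇝ (y ⇝ (0 ⇝ x)†)† = y† ⇝ x := by
  rw [← zero_imp_imp_neg_self x, ← neg_neg (((0 ⇝ x) ⇝ x†) ⇝ (y ⇝ (0 ⇝ x)†)†),
    imp_imp_imp_neg_neg_neg (0 ⇝ x) x† y, neg_imp_imp_neg x y 0, neg_neg (y† ⇝ x)]

theorem imp_imp_neg_self (x y : A) : x ⇝ (y ⇝ x†) = y ⇝ x† := by
  calc x ⇝ (y ⇝ x†)
    _ = x†† ⇝ (y ⇝ x†) := by rw [neg_neg x]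
    _ = y ⇝ x† := by
      rw [← neg_neg y, ← neg_imp_neg_zero_imp_neg x† y†, ← zero_imp_imp_imp x†† (y† ⇝ (0 ⇝ x†)†)†,
        neg_imp_neg_zero_imp_neg x† y†, ← imp_neg_zero x†, ← zero_imp_neg_zero_imp x†,
        ← imp_neg_zero (0 ⇝ x†), ← imp_neg_imp_right (0 ⇝ x†) (y†† ⇝ x†), zero_imp_imp_neg x† y††,
        neg_imp_self (y†† ⇝ x†)]

theorem neg_imp_imp_neg_left (x y : A) : (x ⇝ y)† ⇝ x† = y† ⇝ x† := by
  rw [← neg_neg ((x ⇝ y)† ⇝ x†), ← imp_imp_imp_neg_neg_neg x (x ⇝ y) 0,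
    neg_neg ((x ⇝ (x ⇝ y)) ⇝ (0 ⇝ x†)†), ← neg_imp_imp_neg (0 ⇝ x†)† x (x ⇝ y),
    imp_imp_imp_neg_neg_neg x y 0, neg_neg (0 ⇝ x†), zero_imp_neg_imp_self x,
    imp_imp_neg_self x y†]

theorem imp_imp_self_left (x y : A) : x ⇝ (x ⇝ y) = x ⇝ y := by
  rw [← zero_imp_imp_imp x y, ← neg_neg (x ⇝ y), ← imp_neg_neg_imp_self (x ⇝ y)† x,
    ← imp_imp_neg_right x† (x ⇝ y)†, ← neg_imp_imp_self (x ⇝ y)† x†, neg_imp_imp_neg_left x y,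
    neg_imp_imp_neg y x† x, neg_imp_self x]

theorem zero_imp_neg_neg_imp (x y : A) : 0 ⇝ (x† ⇝ y)† = x ⇝ (0 ⇝ y†) := by
  rw [← neg_imp_imp_neg_zero x† y, neg_neg x, imp_neg_zero y]

theorem zero_imp_neg_imp_of_le {a b : A} (h : a ⇝ b† = a†) : (0 ⇝ a†) ⇝ b = a† ⇝ b := by
  rw [← imp_neg_zero a, ← imp_neg_imp_right a b, h]

theorem neg_zero_imp_imp_neg (x y : A) : ((0 ⇝ x) ⇝ y†)† = (x ⇝ 0†) ⇝ y := by
  rw [zero_imp_imp x y†, ← neg_imp_imp_neg_neg y x 0†, neg_zero_imp y]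

theorem neg_imp_neg_of_le {a b : A} (h : a ⇝ b† = a†) : (b ⇝ a†)† = a := by
  rw [← zero_imp_imp_imp_self a† b, zero_imp_neg_imp_of_le h, ← zero_imp_imp b a†,
    neg_zero_imp_imp_neg b a, imp_neg_zero b, zero_imp_imp b† a, h, neg_imp_self a]

theorem imp_neg_of_le {a b : A} (h : a ⇝ b† = a†) : b ⇝ a† = a† := by
  rw [← neg_neg (b ⇝ a†), neg_imp_neg_of_le h]

theorem zero_imp_neg_imp_of_le_right {a b : A} (h : a ⇝ b† = a†) : 0 ⇝ (b† ⇝ a) = 0 ⇝ a := by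
  rw [← zero_imp_imp_imp_self a b†, zero_imp_imp_neg_of_le h, zero_imp_imp_comm (b† ⇝ a)† a,
    ← zero_imp_imp_neg_of_le h, ← imp_imp_self_left (0 ⇝ a) b†,
    ← zero_imp_imp ((0 ⇝ a) ⇝ b†) (0 ⇝ a), zero_imp_imp_neg_of_le h, zero_imp_neg_neg_imp b a,
    ← zero_imp_imp_comm b a†, imp_neg_of_le h, ← zero_imp_imp_comm (0 ⇝ a†) a,
    zero_imp_neg_imp_self a]

theorem neg_zero_imp_imp (x y : A) : (0 ⇝ x)† ⇝ y = 0 ⇝ (x† ⇝ y) := by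
  rw [← neg_imp_imp_neg_neg y (0 ⇝ x) 0, ← zero_imp_imp_comm y† x,
    neg_zero_imp_imp_neg (y† ⇝ x) (0 ⇝ y), imp_neg_zero (y† ⇝ x), zero_imp_neg_neg_imp y x,
    ← zero_imp_imp_comm (y ⇝ (0 ⇝ x†)) y, ← zero_imp_imp (0 ⇝ x†) y, imp_imp_self_left 0 x†,
    zero_imp_zero_imp_imp x† y]

theorem neg_imp_imp_imp_self (x y w : A) : ((x† ⇝ y) ⇝ w) ⇝ x = (y ⇝ w) ⇝ x := by
  rw [← neg_imp_imp_neg_neg x (x† ⇝ y) w, imp_imp_self_left x† y, neg_imp_imp_neg x y w,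
    neg_neg ((y ⇝ w) ⇝ x)]

theorem zero_imp_neg_zero_imp_self (x : A) : 0 ⇝ (0 ⇝ x)† = 0 ⇝ x† := by
  rw [zero_imp_neg_zero_imp x, imp_neg_zero x]

theorem imp_imp_neg_zero_imp (x y : A) : (x ⇝ y) ⇝ (0 ⇝ y)† = (x ⇝ y)† := by
  calc (x ⇝ y) ⇝ (0 ⇝ y)†
    _ = (x ⇝ (y† ⇝ y)) ⇝ ((0 ⇝ y)† ⇝ y)† := by rw [neg_imp_self y, imp_imp_imp_cancel 0 y]
    _ = (x ⇝ y)† := by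
      rw [← neg_imp_imp_neg_neg ((0 ⇝ y)† ⇝ y)† x (y† ⇝ y), neg_imp_imp_neg_neg y y (0 ⇝ y)†,
        neg_neg ((0 ⇝ y)† ⇝ y), ← neg_imp_neg_imp_self y (0 ⇝ y)†, imp_imp_imp_cancel 0 y,
        neg_imp_neg_imp_self y 0, neg_imp_self y, ← zero_imp_imp_imp_self y x]

theorem imp_neg_zero_imp_of_le {a b : A} (h : a ⇝ b† = a†) : a ⇝ (0 ⇝ b)† = a† := by
  rw [← neg_neg b, ← zero_imp_neg_zero_imp_self b†, ← neg_neg a, ← h, ← imp_imp_neg_zero_imp a b†,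
    h, imp_imp_neg_zero_imp a† (0 ⇝ b†)†, ← h, imp_imp_neg_zero_imp a b†, h]

theorem neg_imp_comm_of_le {a b : A} (h : a ⇝ b† = a†) : a† ⇝ b = b† ⇝ a := by
  rw [← zero_imp_neg_imp_of_le h, ← imp_neg_zero a, ← neg_zero_imp_imp_neg a b,
    zero_imp_imp_neg_of_le h, neg_neg (b† ⇝ a)]

theorem neg_zero_imp_imp_of_le {a b : A} (h : a ⇝ b† = a†) : (0 ⇝ b)† ⇝ a = 0 ⇝ a := by
  calc (0 ⇝ b)† ⇝ a
    _ = (0 ⇝ b)† ⇝ a†† := by rw [neg_neg a]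
    _ = 0 ⇝ a := by
      rw [← imp_neg_zero_imp_of_le h, ← imp_imp_neg_right a (0 ⇝ b)†, imp_neg_zero_imp_of_le h,
        neg_neg (0 ⇝ b), ← zero_imp_imp_comm a† b, neg_imp_comm_of_le h,
        zero_imp_neg_imp_of_le_right h]

theorem zero_imp_neg_zero_imp_of_le {a b : A} (h : a ⇝ b† = a†) : 0 ⇝ ((0 ⇝ a)† ⇝ b) = 0 ⇝ a := by
  calc 0 ⇝ ((0 ⇝ a)† ⇝ b)
    _ = ((0 ⇝ b)† ⇝ a)† ⇝ (0 ⇝ b) := by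
      rw [zero_imp_imp_comm (0 ⇝ a)† b, ← neg_zero_imp_imp_of_le h]
    _ = 0 ⇝ a := by
      rw [neg_imp_imp_imp_self (0 ⇝ b) a 0, ← zero_imp_imp_comm a† b, neg_imp_comm_of_le h,
        zero_imp_neg_imp_of_le_right h]

theorem neg_zero_imp_imp_right_of_le {a b : A} (h : a ⇝ b† = a†) : (0 ⇝ a)† ⇝ b = 0 ⇝ a := by
  rw [← neg_imp_self ((0 ⇝ a)† ⇝ b), ← neg_imp_neg_imp_self ((0 ⇝ a)† ⇝ b) 0,
    zero_imp_neg_zero_imp_of_le h, ← zero_imp_imp b (0 ⇝ a)†, neg_zero_imp_imp_neg b (0 ⇝ a),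
    imp_neg_zero b, ← zero_imp_imp_comm (0 ⇝ b†) a, zero_imp_imp b† a, h, neg_imp_self a]

theorem imp_neg_zero_imp_imp_of_le {a b : A} (h : a ⇝ b† = a†) (x : A) :
    (x ⇝ (0 ⇝ b)†) ⇝ a = x† ⇝ a := by
  rw [← neg_neg (x† ⇝ a), ← neg_imp_imp_neg a x 0, ← imp_neg_zero_imp_of_le h,
    ← neg_zero_imp_imp_right_of_le h, ← imp_imp_neg_zero_imp (0 ⇝ a)† b,
    neg_zero_imp_imp_right_of_le h, ← neg_neg (a ⇝ (0 ⇝ b)†), ← neg_imp_imp_neg_neg (0 ⇝ b)† 0 a,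
    neg_imp_imp_neg_neg (a ⇝ (0 ⇝ b)†)† x (0 ⇝ b)†††, neg_neg (0 ⇝ b), imp_neg_zero_imp_of_le h,
    neg_neg a]

theorem zero_imp_neg_imp_right (x y : A) : (0 ⇝ (x ⇝ y)†) ⇝ y = (0 ⇝ x) ⇝ y := by
  rw [← imp_neg_zero (x ⇝ y), ← zero_imp_neg_imp_neg_zero x,
    ← zero_imp_neg_zero_imp_self (x ⇝ 0†), ← imp_neg_zero (0 ⇝ (x ⇝ 0†)),
    zero_imp_imp (x ⇝ 0†) 0†, ← imp_neg_imp_right (0† ⇝ (x ⇝ 0†)) y, neg_zero_imp (x ⇝ 0†),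
    ← imp_neg_imp_right x y†, imp_neg_imp_right (x ⇝ y††) y, neg_neg y]

theorem imp_neg_zero_imp (x : A) : x ⇝ (0 ⇝ x)† = x† := by
  calc x ⇝ (0 ⇝ x)†
    _ = x†† ⇝ (x† ⇝ 0†)† := by rw [imp_neg_zero x†, neg_neg x]
    _ = x† := by
      rw [← neg_neg (x†† ⇝ (x† ⇝ 0†)†), imp_neg_zero x†, neg_imp_neg_imp_self x†† 0, neg_neg x†,
        imp_neg_self x†, neg_neg x†]

theorem le_trans {a b c : A} (hab : a ⇝ b† = a†) (hbc : b ⇝ c† = b†) : a ⇝ c† = a† := by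
  have neg_neg_imp_imp : (b† ⇝ a)† ⇝ c = a† ⇝ c := by
    rw [← hbc, ← hab, ← neg_imp_imp_imp_self c a b†, ← neg_imp_imp_neg_neg b† c† a, hab,
      neg_neg b, neg_neg a]
  have neg_imp_neg_imp : c† ⇝ (b† ⇝ a) = c† ⇝ a := by
    rw [← neg_imp_imp_neg_neg (b† ⇝ a) c 0, zero_imp_imp_comm b† a, neg_neg_imp_imp,
      ← zero_imp_imp_comm b† a, zero_imp_neg_imp_of_le_right hab, neg_imp_imp_neg a c 0,
      neg_neg (c† ⇝ a)]
  have zero_imp_imp_neg_imp : (0 ⇝ (a ⇝ c†)) ⇝ b = b† ⇝ a := by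
    rw [zero_imp_imp_comm a c†, ← zero_imp_neg_neg_imp a c, ← imp_neg_zero (a† ⇝ c),
      ← imp_neg_imp_right (a† ⇝ c) b, ← imp_imp_imp_neg_neg_neg b a† c, neg_imp_neg_of_le hbc,
      ← zero_imp_imp a† b, zero_imp_neg_imp_of_le hab, neg_imp_comm_of_le hab,
      neg_imp_imp_imp_self b a 0, neg_imp_comm_of_le hab]
  have imp_imp_neg_neg_b (x : A) : ((x ⇝ c) ⇝ b†)† = (0 ⇝ x) ⇝ b := by
    rw [← neg_imp_imp_neg b† x c, neg_imp_neg_of_le hbc, neg_neg b, ← zero_imp_imp x b]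
  have neg_imp_imp_neg_c : ((b† ⇝ a) ⇝ c†)† = b† ⇝ a := by
    rw [← zero_imp_imp_neg_imp, ← neg_imp_imp_neg c† (0 ⇝ (a ⇝ c†)) b, hbc, neg_neg c, neg_neg b,
      ← zero_imp_imp_comm c (a ⇝ c†), ← imp_imp_neg_neg_b (c ⇝ (a ⇝ c†)),
      ← zero_imp_imp (a ⇝ c†) c, imp_imp_neg_neg_b (0 ⇝ (a ⇝ c†)), imp_imp_self_left 0 (a ⇝ c†)]
  have zero_imp_imp_neg_c : (0 ⇝ a) ⇝ c† = (c† ⇝ a)† := by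
    rw [← zero_imp_neg_imp_of_le_right hab, ← neg_zero_imp_imp b a,
      ← neg_imp_imp_imp_self c† (0 ⇝ b)† a, imp_neg_zero_imp_imp_of_le hab c††, neg_neg c†,
      ← neg_imp_neg_imp, ← neg_imp_neg_imp_self c† (b† ⇝ a), neg_imp_imp_neg_c]
  have zero_imp_neg_imp : 0 ⇝ (c† ⇝ a) = 0 ⇝ a := by
    calc 0 ⇝ (c† ⇝ a)
      _ = 0 ⇝ ((a†† ⇝ (0 ⇝ c†)) ⇝ (b ⇝ a†)†) := by
        rw [← zero_imp_zero_imp_imp c† a, neg_imp_neg_of_le hab, neg_neg a,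
          ← zero_imp_imp (0 ⇝ c†) a, imp_imp_self_left 0 c†]
      _ = 0 ⇝ a := by
        rw [neg_imp_imp_neg a† (0 ⇝ c†) b, zero_imp_imp c† b, hbc, neg_imp_self b,
          imp_neg_of_le hab, neg_neg a]
  have zero_imp_imp_neg_a : (0 ⇝ c) ⇝ a† = a† := by
    rw [← zero_imp_neg_imp_right c a†, ← zero_imp_neg_zero_imp_self (c ⇝ a†),
      zero_imp_imp_comm c a†, ← zero_imp_neg_neg_imp c a, ← zero_imp_neg_zero_imp_self (c† ⇝ a),
      zero_imp_neg_imp, zero_imp_neg_zero_imp_self a, zero_imp_neg_zero_imp_self a†, neg_neg a,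
      imp_imp_neg_right 0 a, imp_neg_zero_imp a]
  have imp_neg_a : c ⇝ a† = a† := by
    rw [← zero_imp_imp_imp_self a† c, ← zero_imp_neg_zero_imp_self a, ← imp_neg_zero (0 ⇝ a),
      ← imp_neg_imp_right (0 ⇝ a) c, zero_imp_imp_neg_c, neg_imp_imp_imp_self c a 0,
      ← zero_imp_imp c a†, zero_imp_imp_neg_a]
  rw [← neg_imp_self (a ⇝ c†), ← neg_imp_neg_imp_self (a ⇝ c†) 0, ← zero_imp_zero_imp_imp a c†,
    zero_imp_imp_neg_c, zero_imp_neg_neg_imp c a, ← zero_imp_imp_comm c a†, imp_neg_a,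
    imp_imp_imp_neg_neg_neg a c† 0, neg_neg c, imp_neg_a]

theorem le_iff {a b : A} : (a ⇝ b†)† = a ↔ a ⇝ b† = a† :=
  ⟨fun h => by rw [← neg_neg (a ⇝ b†), h], fun h => by rw [h, neg_neg]⟩

theorem le_antisymm {a b : A} (hab : a ⇝ b† = a†) (hba : b ⇝ a† = b†) : a = b := by
  rw [← neg_neg a, ← imp_neg_of_le hab, hba, neg_neg]

theorem isPartialOrder : IsPartialOrder A (fun x y => (x ⇝ y†)† = x) where
  refl a := le_iff.2 (imp_neg_self a)
  trans _ _ _ hab hbc := le_iff.2 (le_trans (le_iff.1 hab) (le_iff.1 hbc))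
  antisymm _ _ hab hba := le_antisymm (le_iff.1 hab) (le_iff.1 hba)

end InvolutiveZroupoid

theorem stmt_14 (A : Type*) (i : A → A → A) (z : A)
    (hI : ∀ x y w : A, i (i x y) w = i (i (i (i w z) x) (i (i y w) z)) z)
    (hI0 : i (i z z) z = z)
    (h2 : ∀ x : A, i (i x z) z = x) :
    IsPartialOrder A (fun x y => i (i x (i y z)) z = x) := by
  let : InvolutiveZroupoid A := { zero := z, imp := i, imp_imp := hI, imp_zero_imp_zero := h2 }
  exact InvolutiveZroupoid.isPartialOrder
end

section
/- Let A be an algebra in I₂,₀ on which the relation ⊑ (defined by x ⊑ y iff (x → y')' = x) is total, i.e., for all a, b either a ⊑ b or b ⊑ a. Then A satisfies the identity a' → b' = b → a. -/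
/-- The identities of an implication zroupoid with operation `i`, constant `z` and involutive
negation `x ↦ i x z`, that is, of a member of the variety `I₂,₀`. -/
structure IsInvolutiveZroupoid {A : Type*} (i : A → A → A) (z : A) : Prop where
  imp_imp : ∀ x y w : A, i (i x y) w = i (i (i (i w z) x) (i (i y w) z)) z
  neg_neg : ∀ x : A, i (i x z) z = x

namespace IsInvolutiveZroupoid

variable {A : Type*} {i : A → A → A} {z : A}

theorem top_imp (h : IsInvolutiveZroupoid i z) (x : A) :
    i (i z z) x = x := by
  grind [h.imp_imp, h.neg_neg]

theorem neg_imp_self (h : IsInvolutiveZroupoid i z) (x : A) :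
    i (i x z) x = x := by
  have zero_imp (y w : A) : i (i z y) w = i (i w (i (i y w) z)) z := by
    rw [h.imp_imp z y w, h.neg_neg w]
  have zero_imp_top : i z (i z z) = i z z := by
    grind only [zero_imp (i z z) z, h.top_imp (i (i z (i z z)) z), h.neg_neg (i z (i z z)),
      h.top_imp (i z z)]
  grind only [zero_imp (i z z) (i x z), h.neg_neg (i (i x z) (i (i (i z z) (i x z)) z)),
    h.top_imp (i x z), h.neg_neg x]

theorem zero_imp_imp (h : IsInvolutiveZroupoid i z) (x y : A) :
    i (i x (i (i y x) z)) z = i (i z y) x := by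
  grind [h.imp_imp, h.neg_neg, h.top_imp, h.neg_imp_self]

theorem imp_imp_self (h : IsInvolutiveZroupoid i z) (x y : A) :
    i (i x y) x = i (i z y) x := by
  rw [← h.zero_imp_imp]
  grind [h.imp_imp, h.neg_neg, h.top_imp, h.neg_imp_self]

theorem imp_neg_imp_self (h : IsInvolutiveZroupoid i z) (x y : A) :
    i (i x (i y z)) y = i (i x (i z z)) y := by
  rw [h.imp_imp x (i y z) y, h.imp_imp x (i z z) y, h.neg_imp_self, h.top_imp]

theorem imp_neg_self (h : IsInvolutiveZroupoid i z) (x : A) :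
    i x (i x z) = i x z := by
  grind only [h.neg_imp_self (i x z),
    h.neg_neg x]

theorem neg_imp_imp_neg_neg (h : IsInvolutiveZroupoid i z) (x y w : A) :
    i (i (i (i x z) y) (i (i w x) z)) z = i (i y w) x := by
  grind only [h.imp_imp y w x]

theorem zero_imp_neg_imp_self (h : IsInvolutiveZroupoid i z) (x : A) :
    i (i z (i x z)) x = x := by
  grind only [h.neg_imp_self x,
    h.imp_neg_self x,
    h.imp_imp_self x (i x z)]

theorem imp_top_imp_self (h : IsInvolutiveZroupoid i z) (x : A) :
    i (i x (i z z)) x = x := by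
  grind only [h.top_imp x,
    h.imp_neg_self z,
    h.imp_imp_self x (i z z)]

theorem neg_imp_top (h : IsInvolutiveZroupoid i z) (x : A) :
    i (i x z) (i z z) = i z x := by
  grind only [h.neg_imp_imp_neg_neg (i z z) x z,
    h.zero_imp_neg_imp_self z,
    h.neg_neg (i z x),
    h.neg_neg z]

theorem zero_imp_imp_top_imp_self (h : IsInvolutiveZroupoid i z) (x : A) :
    i (i (i z x) (i z z)) x = x := by
  grind only [h.top_imp x,
    h.imp_imp_self (i z z) x,
    h.imp_top_imp_self (i (i z z) x)]

theorem imp_top (h : IsInvolutiveZroupoid i z) (x : A) :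
    i x (i z z) = i z (i x z) := by
  grind only [h.neg_imp_top (i x z),
    h.neg_neg x]

theorem neg_imp_imp_imp_neg (h : IsInvolutiveZroupoid i z) (x y w : A) :
    i (i (i x z) y) (i (i w x) z) = i (i (i y w) x) z := by
  grind only [h.neg_imp_imp_neg_neg x y w,
    h.neg_neg (i (i (i x z) y) (i (i w x) z))]

theorem zero_imp_neg_imp_top (h : IsInvolutiveZroupoid i z) (x : A) :
    i z (i (i x (i z z)) z) = i z x := by
  grind only [h.neg_imp_imp_neg_neg (i z z) x (i z z),
    h.zero_imp_imp_top_imp_self z,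
    h.imp_top (i x (i z z)),
    h.neg_neg (i z x),
    h.neg_neg z]

theorem imp_imp_imp_neg (h : IsInvolutiveZroupoid i z) (x y w : A) :
    i (i (i x y) (i (i w (i x z)) z)) z = i (i y w) (i x z) := by
  grind only [h.neg_imp_imp_neg_neg (i x z) y w,
    h.neg_neg x]

theorem neg_zero_imp_imp_neg (h : IsInvolutiveZroupoid i z) (x y : A) :
    i (i (i z x) (i y z)) z = i (i x (i z z)) y := by
  grind only [h.top_imp y,
    h.neg_imp_imp_neg_neg y x (i z z),
    h.imp_imp_self (i y z) x]

theorem zero_imp_zero_imp (h : IsInvolutiveZroupoid i z) (x : A) :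
    i z (i z x) = i z x := by
  grind only [h.zero_imp_neg_imp_top (i z x), h.zero_imp_neg_imp_top x,
    h.neg_zero_imp_imp_neg x z]

theorem zero_imp_neg_zero_imp (h : IsInvolutiveZroupoid i z) (x : A) :
    i z (i (i z x) z) = i z (i x z) := by
  grind only [h.imp_top x, h.imp_top (i z x), h.imp_imp_self (i z z) x, h.top_imp x]

theorem neg_imp_imp_self (h : IsInvolutiveZroupoid i z) (x y : A) :
    i (i (i x y) x) z = i (i y x) (i x z) := by
  grind only [h.imp_neg_self x,
    h.neg_imp_imp_neg_neg (i x z) y x,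
    h.neg_neg x]

theorem imp_zero_imp_imp (h : IsInvolutiveZroupoid i z) (x y w : A) :
    i (i x (i z y)) w = i (i x (i w y)) w := by
  grind only [h.neg_imp_imp_neg_neg w x (i w y),
    h.neg_imp_imp_neg_neg w x (i z y),
    h.imp_imp_self w y]

theorem zero_imp_imp_zero_imp (h : IsInvolutiveZroupoid i z) (x y : A) :
    i z (i x (i z y)) = i z (i x y) := by
  grind only [h.top_imp y,
    h.imp_top (i x (i z y)),
    h.zero_imp_neg_zero_imp (i (i x (i z y)) z),
    h.zero_imp_neg_imp_top (i x (i (i z z) y)),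
    h.imp_zero_imp_imp x y (i z z),
    h.neg_neg (i x (i z y))]

theorem neg_zero_imp_imp (h : IsInvolutiveZroupoid i z) (x y : A) :
    i (i (i z x) y) z = i y (i (i x y) z) := by
  grind only [h.zero_imp_imp y x,
    h.neg_neg (i y (i (i x y) z))]

theorem imp_top_imp_zero_imp (h : IsInvolutiveZroupoid i z) (x y : A) :
    i (i x (i z z)) (i z y) = i (i x z) (i z y) := by
  grind only [h.zero_imp_zero_imp y,
    h.neg_imp_imp_neg_neg (i z y) x z,
    h.imp_imp_self (i (i z y) z) x,
    h.neg_zero_imp_imp_neg x (i z y)]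

theorem imp_neg_zero_imp (h : IsInvolutiveZroupoid i z) (x : A) :
    i x (i (i z x) z) = i x z := by
  grind only [h.top_imp x,
    h.neg_zero_imp_imp z x]

theorem zero_imp_imp_zero_imp_eq (h : IsInvolutiveZroupoid i z) (x y : A) :
    i (i z x) (i z y) = i x (i z y) := by
  grind only [h.imp_top (i x (i z z)),
    h.imp_neg_imp_self x (i z z),
    h.zero_imp_neg_imp_top x,
    h.imp_top_imp_zero_imp (i x (i (i z z) z)) y,
    h.neg_neg x,
    h.neg_neg z]

theorem zero_imp_zero_imp_imp (h : IsInvolutiveZroupoid i z) (x y : A) :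
    i z (i (i z x) y) = i z (i x y) := by
  grind only [h.zero_imp_imp_zero_imp (i z x) y,
    h.zero_imp_imp_zero_imp x y,
    h.zero_imp_imp_zero_imp_eq x y]

theorem imp_top_imp_imp (h : IsInvolutiveZroupoid i z) (x y : A) :
    i (i x (i z z)) (i y x) = i y x := by
  grind only [h.top_imp y,
    h.neg_imp_imp_neg_neg x (i z z) y,
    h.neg_imp_top x,
    h.neg_zero_imp_imp_neg x (i y x)]

theorem zero_imp_neg_imp_imp (h : IsInvolutiveZroupoid i z) (x y : A) :
    i (i z (i x z)) (i y x) = i y x := by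
  grind only [h.top_imp x,
    h.imp_imp_self (i z z) x,
    h.imp_top (i z x),
    h.zero_imp_zero_imp_imp x z,
    h.imp_top_imp_imp (i (i z z) x) y]

theorem zero_imp_neg_imp (h : IsInvolutiveZroupoid i z) (x y : A) :
    i (i z (i x z)) y = i (i x (i y z)) y := by
  grind only [h.imp_top x,
    h.imp_neg_imp_self x y]

theorem imp_imp_neg (h : IsInvolutiveZroupoid i z) (x y : A) :
    i (i x y) (i y z) = i y (i (i x y) z) := by
  grind only [h.neg_imp_self y,
    h.neg_imp_imp_imp_neg y y x,
    h.neg_imp_imp_self y x]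

theorem neg_imp_imp_imp (h : IsInvolutiveZroupoid i z) (x y w v : A) :
    i (i (i (i x y) w) (i (i v x) y)) z = i (i w (i (i y z) v)) (i (i x y) z) := by
  grind only [h.neg_imp_imp_neg_neg (i (i x y) z) w (i (i y z) v),
    h.neg_imp_imp_neg_neg y v x,
    h.neg_neg (i x y)]

theorem imp_imp_self_imp (h : IsInvolutiveZroupoid i z) (x y : A) :
    i (i (i x y) x) y = i x y := by
  grind only [h.top_imp x,
    h.neg_zero_imp_imp (i y z) (i x y),
    h.zero_imp_neg_imp_imp y x,
    h.imp_imp_neg (i y z) (i x y),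
    h.neg_imp_imp_imp y z (i x y) x,
    h.neg_neg (i x y),
    h.neg_neg y]

theorem zero_imp_imp_imp (h : IsInvolutiveZroupoid i z) (x y : A) :
    i (i (i z x) y) x = i y x := by
  grind only [h.imp_imp_self y x,
    h.imp_imp_self_imp y x]

theorem zero_imp_neg_imp_imp_right (h : IsInvolutiveZroupoid i z) (x y : A) :
    i (i z (i (i x y) z)) y = i (i z x) y := by
  grind only [h.imp_top (i x y),
    h.imp_neg_imp_self (i x (i (i y z) z)) y,
    h.zero_imp_zero_imp_imp (i x z) z,
    h.zero_imp_neg_imp (i z (i x z)) y,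
    h.zero_imp_neg_imp x (i y z),
    h.neg_neg x,
    h.neg_neg y]

theorem neg_zero_imp_imp_imp (h : IsInvolutiveZroupoid i z) (x y : A) :
    i (i (i (i z x) y) z) (i x y) = i x y := by
  grind only [h.neg_zero_imp_imp x y,
    h.zero_imp_neg_imp_imp y x,
    h.zero_imp_neg_imp y (i x y)]

theorem imp_neg_imp (h : IsInvolutiveZroupoid i z) (x y : A) :
    i x (i (i y x) z) = i (i y (i z z)) (i x z) := by
  grind only [h.imp_neg_imp_self y (i x z),
    h.imp_imp_neg y x,
    h.neg_neg x]

theorem neg_imp_zero_imp (h : IsInvolutiveZroupoid i z) (x y : A) :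
    i (i (i x y) z) (i (i z x) y) = i x y := by
  grind only [h.imp_neg_imp (i (i x y) z) y,
    h.zero_imp_imp y x,
    h.imp_top_imp_imp y x,
    h.neg_neg (i x y)]

theorem imp_imp_neg_zero_imp (h : IsInvolutiveZroupoid i z) (x y : A) :
    i (i x y) (i (i z y) z) = i (i x y) z := by
  grind only [h.neg_imp_zero_imp y z,
    h.imp_imp_imp_neg (i z y) x (i (i y z) z),
    h.zero_imp_imp_imp y x,
    h.neg_neg y]

theorem imp_zero_imp_imp_imp (h : IsInvolutiveZroupoid i z) (x y w : A) :
    i (i x (i (i z y) w)) y = i (i x w) y := by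
  grind only [h.imp_imp_neg_zero_imp w y,
    h.neg_imp_imp_imp_neg y x w,
    h.imp_neg_zero_imp y,
    h.neg_imp_imp_imp y (i (i z y) z) x w,
    h.neg_neg (i (i x w) y),
    h.neg_neg (i z y),
    h.neg_neg y]

theorem zero_imp_imp_imp_imp (h : IsInvolutiveZroupoid i z) (x y w : A) :
    i (i (i (i z (i x y)) w) y) x = i (i w y) x := by
  grind only [h.imp_zero_imp_imp_imp (i (i z (i (i z x) y)) w) x y,
    h.imp_zero_imp_imp_imp w x y,
    h.zero_imp_zero_imp_imp x y,
    h.zero_imp_imp_imp (i (i z x) y) w]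

theorem neg_imp_imp (h : IsInvolutiveZroupoid i z) (x y : A) :
    i (i x z) (i y x) = i y x := by
  grind only [h.zero_imp_imp_imp_imp (i y x) z x,
    h.zero_imp_neg_imp_imp_right y x,
    h.neg_zero_imp_imp_imp y x]

theorem imp_imp_neg_self (h : IsInvolutiveZroupoid i z) (x y : A) :
    i x (i y (i x z)) = i y (i x z) := by
  grind only [h.neg_imp_imp (i x z) y,
    h.neg_neg x]

end IsInvolutiveZroupoid

theorem stmt_19 (A : Type*) (i : A → A → A) (z : A)
    (hI : ∀ x y w : A, i (i x y) w = i (i (i (i w z) x) (i (i y w) z)) z)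
    (hI0 : i (i z z) z = z)
    (h2 : ∀ x : A, i (i x z) z = x)
    (htot : ∀ a b : A, i (i a (i b z)) z = a ∨ i (i b (i a z)) z = b) :
    ∀ a b : A, i (i a z) (i b z) = i b a := by
  have h : IsInvolutiveZroupoid i z := ⟨hI, h2⟩
  have comm_of_le : ∀ a b : A, i (i a (i b z)) z = a → i a (i b z) = i b (i a z) := by
    intro a b hab
    have hneg : i a (i b z) = i a z := by rw [← h2 (i a (i b z)), hab]
    have key := h.imp_imp_neg_self b a
    rw [hneg] at key
    rw [hneg, key]
  intro a b
  rcases htot (i a z) b with hab | hab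
  · rw [comm_of_le _ _ hab, h2]
  · rw [← comm_of_le _ _ hab, h2]
end
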